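/- For every natural number n, the word w_n = s⁻¹(b⁻ⁿa⁻¹bⁿ r b⁻ⁿabⁿ)⁻¹ s (b⁻ⁿa⁻¹bⁿ r b⁻ⁿabⁿ) has length 8n+8 and is null-homotopic over the presentation Q, i.e. it represents the identity of the group presented by Q. -/

import Mathlib

/-! Words over an alphabet `A`: a letter `(x, true)` is the generator `x`,
and `(x, false)` is its formal inverse `x⁻¹`. -/

/-- A word over the alphabet `A ∪ A⁻¹`. -/
abbrev Word (A : Type*) := List (A × Bool)

namespace Word

/-- The formal inverse of a word. -/
def inv {A : Type*} (w : Word A) : Word A := (w.map fun p => (p.1, !p.2)).reverse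

/-- `w'` is a cyclic conjugate (cyclic permutation) of `w`. -/
def IsCyclicConj {A : Type*} (w w' : Word A) : Prop :=
  ∃ u v : Word A, w = u ++ v ∧ w' = v ++ u

end Word

/-- Moves (i)–(iii) on words with respect to a set `R` of relator words:
free reduction, free expansion, and application of a relator (replace a subword `u`
by `v` where some cyclic conjugate of `u * v⁻¹` lies in `R ∪ R⁻¹`). -/
inductive Move {A : Type*} (R : Set (Word A)) : Word A → Word A → Prop
  | freeReduce (u v : Word A) (x : A) (b : Bool) :
      Move R (u ++ (x, b) :: (x, !b) :: v) (u ++ v)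
  | freeExpand (u v : Word A) (x : A) (b : Bool) :
      Move R (u ++ v) (u ++ (x, b) :: (x, !b) :: v)
  | relator (p q u v z : Word A)
      (hz : Word.IsCyclicConj (u ++ Word.inv v) z) (hR : z ∈ R ∨ Word.inv z ∈ R) :
      Move R (p ++ u ++ q) (p ++ v ++ q)

/-- Moves (i)–(iv): moves (i)–(iii) together with cyclic conjugation. -/
inductive MoveC {A : Type*} (R : Set (Word A)) : Word A → Word A → Prop
  | of {w w' : Word A} : Move R w w' → MoveC R w w'
  | cyc {w w' : Word A} : Word.IsCyclicConj w w' → MoveC R w w'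

/-- Moves (i)–(v) on finite sequences of words: one of the moves (i)–(iv) applied to
one word of the sequence, or fragmentation of one word `u ++ v` into `u` and `v`. -/
inductive MoveF {A : Type*} (R : Set (Word A)) : List (Word A) → List (Word A) → Prop
  | of (l₁ l₂ : List (Word A)) {w w' : Word A} :
      MoveC R w w' → MoveF R (l₁ ++ w :: l₂) (l₁ ++ w' :: l₂)
  | frag (l₁ l₂ : List (Word A)) (u v : Word A) :
      MoveF R (l₁ ++ (u ++ v) :: l₂) (l₁ ++ u :: v :: l₂)

/-- A word is null-homotopic over the presentation with relator set `R` if it represents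
the identity of the presented group, i.e. lies in the normal closure of the relators. -/
def NullHomotopic {A : Type*} (R : Set (Word A)) (w : Word A) : Prop :=
  FreeGroup.mk w ∈ Subgroup.normalClosure (FreeGroup.mk '' R)

/-- `FLle R w L`: the word `w` can be converted to the empty word by moves (i)–(iii)
with every intermediate word of length at most `L`. -/
def FLle {A : Type*} (R : Set (Word A)) (w : Word A) (L : ℕ) : Prop :=
  ∃ (m : ℕ) (f : ℕ → Word A), f 0 = w ∧ f m = [] ∧
    (∀ i < m, Move R (f i) (f (i + 1))) ∧ ∀ i ≤ m, (f i).length ≤ L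

/-- `FFLle R w L`: the word `w` can be converted to the empty word by moves (i)–(iv)
with every intermediate word of length at most `L`. -/
def FFLle {A : Type*} (R : Set (Word A)) (w : Word A) (L : ℕ) : Prop :=
  ∃ (m : ℕ) (f : ℕ → Word A), f 0 = w ∧ f m = [] ∧
    (∀ i < m, MoveC R (f i) (f (i + 1))) ∧ ∀ i ≤ m, (f i).length ≤ L

/-- The total length of a finite sequence of words. -/
def totalLength {A : Type*} (l : List (Word A)) : ℕ := (l.map List.length).sum

/-- `FFFLle R w L`: the length-one sequence `(w)` can be converted to a sequence of empty
words by moves (i)–(v) with every intermediate sequence of total length at most `L`. -/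
def FFFLle {A : Type*} (R : Set (Word A)) (w : Word A) (L : ℕ) : Prop :=
  ∃ (m : ℕ) (f : ℕ → List (Word A)), f 0 = [w] ∧ (∀ u ∈ f m, u = ([] : Word A)) ∧
    (∀ i < m, MoveF R (f i) (f (i + 1))) ∧ ∀ i ≤ m, totalLength (f i) ≤ L

/-- An element `x` of the free group is a conjugate of a relator of `R` or of an inverse
of a relator. -/
def IsConjRelator {A : Type*} (R : Set (Word A)) (x : FreeGroup A) : Prop :=
  ∃ c ρ : FreeGroup A, (ρ ∈ FreeGroup.mk '' R ∨ ρ⁻¹ ∈ FreeGroup.mk '' R) ∧ x = c * ρ * c⁻¹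

/-- `AreaLe R g N`: in the free group, `g` is a product of at most `N` conjugates
of elements of `R ∪ R⁻¹`. -/
def AreaLe {A : Type*} (R : Set (Word A)) (g : FreeGroup A) (N : ℕ) : Prop :=
  ∃ l : List (FreeGroup A), l.length ≤ N ∧ (∀ x ∈ l, IsConjRelator R x) ∧ l.prod = g

/-- The number of occurrences in `w` of the letter `x` or its inverse. -/
def countLtr {A : Type*} [DecidableEq A] (x : A) (w : Word A) : ℕ :=
  (w.filter fun p => p.1 = x).length

/-- The filling length `FL(w)` of a null-homotopic word. -/
noncomputable def FLw {A : Type*} (R : Set (Word A)) (w : Word A) : ℕ :=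
  sInf {L | FLle R w L}

/-- The free filling length `FFL(w)` of a null-homotopic word. -/
noncomputable def FFLw {A : Type*} (R : Set (Word A)) (w : Word A) : ℕ :=
  sInf {L | FFLle R w L}

/-- The fragmenting free filling length `FFFL(w)` of a null-homotopic word. -/
noncomputable def FFFLw {A : Type*} (R : Set (Word A)) (w : Word A) : ℕ :=
  sInf {L | FFFLle R w L}

/-- The filling length function `FL : ℕ → ℕ` of the presentation with relators `R`. -/
noncomputable def FLfn {A : Type*} (R : Set (Word A)) (n : ℕ) : ℕ :=
  sSup (FLw R '' {w | NullHomotopic R w ∧ w.length ≤ n})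

/-- The free filling length function `FFL : ℕ → ℕ`. -/
noncomputable def FFLfn {A : Type*} (R : Set (Word A)) (n : ℕ) : ℕ :=
  sSup (FFLw R '' {w | NullHomotopic R w ∧ w.length ≤ n})

/-- The fragmenting free filling length function `FFFL : ℕ → ℕ`. -/
noncomputable def FFFLfn {A : Type*} (R : Set (Word A)) (n : ℕ) : ℕ :=
  sSup (FFFLw R '' {w | NullHomotopic R w ∧ w.length ≤ n})

/-! The presentation `Q = ⟨a, b, r, s, t | a^b a⁻², [t,a], [r,at], [r,s], [s,t]⟩`. -/

/-- The five generators of the presentation `Q`. -/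
inductive QGen | a | b | r | s | t
deriving DecidableEq

/-- The five relators of `Q`: `b⁻¹aba⁻¹a⁻¹`, `t⁻¹a⁻¹ta`, `r⁻¹t⁻¹a⁻¹rat`,
`r⁻¹s⁻¹rs`, `s⁻¹t⁻¹st`. -/
def QRels : Set (Word QGen) :=
  { [(QGen.b, false), (QGen.a, true), (QGen.b, true), (QGen.a, false), (QGen.a, false)],
    [(QGen.t, false), (QGen.a, false), (QGen.t, true), (QGen.a, true)],
    [(QGen.r, false), (QGen.t, false), (QGen.a, false), (QGen.r, true), (QGen.a, true),
      (QGen.t, true)],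
    [(QGen.r, false), (QGen.s, false), (QGen.r, true), (QGen.s, true)],
    [(QGen.s, false), (QGen.t, false), (QGen.s, true), (QGen.t, true)] }

/-- The word `bⁿ`. -/
def bpow (n : ℕ) : Word QGen := List.replicate n (QGen.b, true)

/-- The word `b⁻ⁿ`. -/
def bpowInv (n : ℕ) : Word QGen := List.replicate n (QGen.b, false)

/-- The word `a^{-bⁿ} = b⁻ⁿ a⁻¹ bⁿ`. -/
def aConjNeg (n : ℕ) : Word QGen := bpowInv n ++ [(QGen.a, false)] ++ bpow n

/-- The word `a^{bⁿ} = b⁻ⁿ a bⁿ`. -/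
def aConjPos (n : ℕ) : Word QGen := bpowInv n ++ [(QGen.a, true)] ++ bpow n

/-- The word `a^{-bⁿ} r a^{bⁿ}`. -/
def gword (n : ℕ) : Word QGen := aConjNeg n ++ [(QGen.r, true)] ++ aConjPos n

/-- The word `w_n = [s, a^{-bⁿ} r a^{bⁿ}] = s⁻¹ (b⁻ⁿa⁻¹bⁿ r b⁻ⁿabⁿ)⁻¹ s (b⁻ⁿa⁻¹bⁿ r b⁻ⁿabⁿ)`. -/
def wn (n : ℕ) : Word QGen :=
  [(QGen.s, false)] ++ Word.inv (gword n) ++ [(QGen.s, true)] ++ gword n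

/-- The word `a^{-bⁿ} r a^{bⁿ} r a^{bⁿ} r⁻¹ a^{-bⁿ}`. -/
def g'word (n : ℕ) : Word QGen :=
  aConjNeg n ++ [(QGen.r, true)] ++ aConjPos n ++ [(QGen.r, true)] ++ aConjPos n ++
    [(QGen.r, false)] ++ aConjNeg n

/-- The word `w'_n = [s, a^{-bⁿ} r a^{bⁿ} r a^{bⁿ} r⁻¹ a^{-bⁿ}]`. -/
def w'n (n : ℕ) : Word QGen :=
  [(QGen.s, false)] ++ Word.inv (g'word n) ++ [(QGen.s, true)] ++ g'word n

/-- The value of a word in a group, given the values of the generators. -/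
def Word.eval {A G : Type*} [Group G] (f : A → G) (w : Word A) : G :=
  FreeGroup.lift f (FreeGroup.mk w)

namespace Word

variable {A G : Type*} [Group G] (f : A → G)

theorem eval_append (u v : Word A) : eval f (u ++ v) = eval f u * eval f v := by
  simp [eval]

theorem eval_singleton_true (x : A) : eval f [(x, true)] = f x := by
  simp [eval]

theorem eval_singleton_false (x : A) : eval f [(x, false)] = (f x)⁻¹ := by
  simp [eval]

theorem eval_replicate (n : ℕ) (p : A × Bool) :
    eval f (List.replicate n p) = eval f [p] ^ n := by
  simp [eval]

theorem eval_inv (w : Word A) : eval f w.inv = (eval f w)⁻¹ := by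
  rw [eval, eval, ← map_inv, FreeGroup.inv_mk]
  rfl

theorem length_inv (w : Word A) : w.inv.length = w.length := by
  simp [inv]

end Word

theorem nullHomotopic_iff_eval_eq_one {A : Type*} (R : Set (Word A)) (w : Word A) :
    NullHomotopic R w ↔
      w.eval (PresentedGroup.of (rels := FreeGroup.mk '' R)) = 1 := by
  have h : FreeGroup.lift (PresentedGroup.of (rels := FreeGroup.mk '' R)) =
      PresentedGroup.mk (FreeGroup.mk '' R) := by
    ext x
    simp [PresentedGroup.of]
  rw [Word.eval, h]
  exact (QuotientGroup.eq_one_iff _).symm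

theorem NullHomotopic.of_mem {A : Type*} {R : Set (Word A)} {w : Word A} (hw : w ∈ R) :
    NullHomotopic R w :=
  Subgroup.subset_normalClosure ⟨w, hw, rfl⟩

/-- If `b` conjugates `a` to `a ^ 2`, then `b ^ n` conjugates `a` to `a ^ 2 ^ n`. -/
theorem inv_pow_mul_mul_pow_eq_pow_two_pow {G : Type*} [Group G] {a b : G}
    (h : b⁻¹ * a * b = a ^ 2) (n : ℕ) : (b ^ n)⁻¹ * a * b ^ n = a ^ 2 ^ n := by
  induction n with
  | zero => simp
  | succ n ih =>
    calc (b ^ (n + 1))⁻¹ * a * b ^ (n + 1)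
        = b⁻¹ * ((b ^ n)⁻¹ * a * b ^ n) * b := by rw [pow_succ]; group
      _ = (b⁻¹ * a * b) ^ 2 ^ n := by
        rw [ih]
        simpa using (conj_pow (i := 2 ^ n) (a := b⁻¹) (b := a)).symm
      _ = a ^ 2 ^ (n + 1) := by rw [h, ← pow_mul, pow_succ']

/-- If `r` commutes with `a * t`, then conjugating `r` by a power of `a` amounts to
conjugating it by the inverse power of `t`. -/
theorem Commute.inv_pow_mul_mul_pow_eq {G : Type*} [Group G] {a r t : G}
    (hat : Commute a t) (hr : Commute r (a * t)) (k : ℕ) :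
    (a ^ k)⁻¹ * r * a ^ k = t ^ k * r * (t ^ k)⁻¹ := by
  have h := (hr.pow_right k).eq
  rw [hat.mul_pow] at h
  have h' := (hat.pow_pow k k).eq
  rw [eq_mul_inv_iff_mul_eq, mul_assoc, mul_assoc, inv_mul_eq_iff_eq_mul, h, mul_assoc]

theorem wn_length_and_nullHomotopic (n : ℕ) :
    (wn n).length = 8 * n + 8 ∧ NullHomotopic QRels (wn n) := by
  constructor
  · simp [wn, gword, aConjNeg, aConjPos, bpow, bpowInv, Word.length_inv]
    ring
  rw [nullHomotopic_iff_eval_eq_one]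
  set f : QGen → PresentedGroup (FreeGroup.mk '' QRels) := PresentedGroup.of
  have rel {w : Word QGen} (hw : w ∈ QRels) : w.eval f = 1 :=
    (nullHomotopic_iff_eval_eq_one _ _).1 (.of_mem hw)
  have hab : (f .b)⁻¹ * f .a * f .b = f .a ^ 2 := by
    have h := rel (.inl rfl)
    simp only [Word.eval, FreeGroup.lift_mk, List.map, List.prod_cons, List.prod_nil, cond] at h
    rw [← mul_inv_eq_one, ← h]
    group
  have hat : Commute (f .a) (f .t) := by
    have h := rel (.inr (.inl rfl))
    simp only [Word.eval, FreeGroup.lift_mk, List.map, List.prod_cons, List.prod_nil, cond] at h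
    rw [Commute, SemiconjBy, ← inv_mul_eq_one, ← h]
    group
  have hr : Commute (f .r) (f .a * f .t) := by
    have h := rel (.inr (.inr (.inl rfl)))
    simp only [Word.eval, FreeGroup.lift_mk, List.map, List.prod_cons, List.prod_nil, cond] at h
    rw [Commute, SemiconjBy, ← inv_mul_eq_one, ← inv_eq_one, ← h]
    group
  have hrs : Commute (f .s) (f .r) := by
    have h := rel (.inr (.inr (.inr (.inl rfl))))
    simp only [Word.eval, FreeGroup.lift_mk, List.map, List.prod_cons, List.prod_nil, cond] at h
    rw [Commute, SemiconjBy, ← inv_mul_eq_one, ← h]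
    group
  have hst : Commute (f .s) (f .t) := by
    have h := rel (.inr (.inr (.inr (.inr rfl))))
    simp only [Word.eval, FreeGroup.lift_mk, List.map, List.prod_cons, List.prod_nil, cond] at h
    rw [Commute, SemiconjBy, ← inv_mul_eq_one, ← inv_eq_one, ← h]
    group
  have hg : (gword n).eval f =
      f .t ^ 2 ^ n * f .r * (f .t ^ 2 ^ n)⁻¹ := by
    rw [← hat.inv_pow_mul_mul_pow_eq hr, ← inv_pow_mul_mul_pow_eq_pow_two_pow hab]
    simp only [gword, aConjNeg, aConjPos, bpow, bpowInv, Word.eval_append, Word.eval_replicate,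
      Word.eval_singleton_true, Word.eval_singleton_false]
    group
  have hsg : Commute (f .s) ((gword n).eval f) := by
    rw [hg]
    exact ((hst.pow_right _).mul_right hrs).mul_right (hst.pow_right _).inv_right
  simp only [wn, Word.eval_append, Word.eval_inv, Word.eval_singleton_true,
    Word.eval_singleton_false]
  rw [mul_assoc, hsg.eq]
  group
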